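/- arXiv:math-ph/0308032 — 3 statements merged into one kernel-verified Lean document; each statement's English description precedes it below -/
import Mathlib

section
/- Let q : ℝ → ℂ be continuous and bounded. Define the Picard iterates u_0(x) = cos(x) and u_j(x) = ∫₀ˣ sin(x−t) q(t) u_{j−1}(t) dt for j ≥ 1, and similarly v_0(x) = sin(x), v_j(x) = ∫₀ˣ sin(x−t) q(t) v_{j−1}(t) dt. Then the series Σ_{j=0}^∞ u_j(x) and Σ_{j=0}^∞ v_j(x) converge uniformly on [0, 2π], and their sums equal the fundamental solutions c(q;1,x) and s(q;1,x), respectively. -/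
noncomputable section

/-- `ψ` is a (twice differentiable) solution of the Hill equation `-ψ'' + q ψ = z ψ` on `ℝ`. -/
def IsHillSolution (q : ℝ → ℂ) (z : ℂ) (ψ : ℝ → ℂ) : Prop :=
  Differentiable ℝ ψ ∧ Differentiable ℝ (deriv ψ) ∧
    ∀ x : ℝ, -deriv (deriv ψ) x + q x * ψ x = z * ψ x

/-- Variation of constants: a solution of `-y'' + q y = y` satisfies the Volterra integral equation
with inhomogeneity `y 0 * cos + y' 0 * sin`. -/
lemma IsHillSolution.eq_add_integral {q y : ℝ → ℂ} (hq : Continuous q)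
    (hy : IsHillSolution q 1 y) (x : ℝ) :
    y x = (Real.cos x : ℂ) * y 0 + (Real.sin x : ℂ) * deriv y 0 +
      ∫ t in (0 : ℝ)..x, (Real.sin (x - t) : ℂ) * q t * y t := by
  obtain ⟨hy1, hy2, heq⟩ := hy
  have hycont : Continuous y := hy1.continuous
  have hderiv (t : ℝ) : HasDerivAt
      (fun t => (Real.cos (x - t) : ℂ) * y t + (Real.sin (x - t) : ℂ) * deriv y t)
      ((Real.sin (x - t) : ℂ) * q t * y t) t := by
    have hsub : HasDerivAt (fun t : ℝ => x - t) (-1) t := by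
      simpa using (hasDerivAt_id t).const_sub x
    have hcos := hsub.cos.ofReal_comp
    have hsin := hsub.sin.ofReal_comp
    refine ((hcos.mul (hy1 t).hasDerivAt).add (hsin.mul (hy2 t).hasDerivAt)).congr_deriv ?_
    push_cast
    linear_combination -Complex.sin (x - t) * heq t
  have hint := intervalIntegral.integral_eq_sub_of_hasDerivAt (a := 0) (b := x)
    (fun t _ => hderiv t)
    (Continuous.intervalIntegrable (by fun_prop) _ _)
  rw [hint]
  simp

/-- The partial sums of the Picard series of a Volterra equation with kernel `sin (x - t) * q t`
converge uniformly on `[0, b]` to any continuous solution of that equation. -/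
lemma tendstoUniformlyOn_sum_picard {q y : ℝ → ℂ} {w : ℕ → ℝ → ℂ} {M : ℝ} (hq : Continuous q)
    (hM : ∀ x, ‖q x‖ ≤ M) (hy : Continuous y) (hw0 : Continuous (w 0))
    (hw : ∀ (j : ℕ) (x : ℝ),
      w (j + 1) x = ∫ t in (0 : ℝ)..x, (Real.sin (x - t) : ℂ) * q t * w j t)
    (heq : ∀ x, y x = w 0 x + ∫ t in (0 : ℝ)..x, (Real.sin (x - t) : ℂ) * q t * y t) (b : ℝ) :
    TendstoUniformlyOn (fun N x => ∑ j ∈ Finset.range N, w j x) y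
      Filter.atTop (Set.Icc 0 b) := by
  have hM0 : 0 ≤ M := (norm_nonneg _).trans (hM 0)
  have hcont (j : ℕ) : Continuous (w j) := by
    induction j with
    | zero => exact hw0
    | succ j ih =>
      rw [funext (hw j)]
      exact intervalIntegral.continuous_parametric_intervalIntegral_of_continuous
        (by fun_prop) continuous_id
  have hrem (N : ℕ) (x : ℝ) : y x - ∑ j ∈ Finset.range (N + 1), w j x =
      ∫ t in (0 : ℝ)..x,
        (Real.sin (x - t) : ℂ) * q t * (y t - ∑ j ∈ Finset.range N, w j t) := by
    simp_rw [mul_sub, Finset.mul_sum]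
    rw [intervalIntegral.integral_sub (Continuous.intervalIntegrable (by fun_prop) _ _)
      (Continuous.intervalIntegrable (by fun_prop) _ _),
      intervalIntegral.integral_finsetSum
        (fun j _ => Continuous.intervalIntegrable (by fun_prop) _ _),
      Finset.sum_range_succ', heq x]
    simp_rw [hw]
    ring
  obtain ⟨K, hK⟩ := isCompact_Icc.exists_bound_of_continuousOn (s := Set.Icc 0 b) hy.continuousOn
  have hbound (N : ℕ) : ∀ x ∈ Set.Icc 0 b,
      ‖y x - ∑ j ∈ Finset.range N, w j x‖ ≤ K * ((M * x) ^ N / N.factorial) := by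
    induction N with
    | zero => simpa using hK
    | succ N ih =>
      intro x hx
      rw [hrem]
      calc _ ≤ ∫ t in (0 : ℝ)..x, M * (K * ((M * t) ^ N / N.factorial)) := by
            refine intervalIntegral.norm_integral_le_of_norm_le hx.1
              (Filter.Eventually.of_forall fun t ht => ?_)
              (Continuous.intervalIntegrable (by fun_prop) _ _)
            rw [norm_mul, norm_mul, Complex.norm_real]
            have hsin : ‖Real.sin (x - t)‖ ≤ 1 := Real.abs_sin_le_one _
            have hle : ‖Real.sin (x - t)‖ * ‖q t‖ ≤ M :=
              (mul_le_of_le_one_left (norm_nonneg _) hsin).trans (hM t)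
            exact mul_le_mul hle (ih t ⟨ht.1.le, ht.2.trans hx.2⟩) (norm_nonneg _) hM0
        _ = K * ((M * x) ^ (N + 1) / (N + 1).factorial) := by
            have hfun : (fun t : ℝ => M * (K * ((M * t) ^ N / N.factorial))) =
                fun t => (M ^ (N + 1) * K / N.factorial) * t ^ N := by
              funext t
              ring
            rw [hfun, intervalIntegral.integral_const_mul, integral_pow, Nat.factorial_succ,
              zero_pow N.succ_ne_zero, sub_zero, mul_pow]
            push_cast
            field_simp
  rw [Metric.tendstoUniformlyOn_iff]
  intro ε hε
  have hlim : Filter.Tendsto (fun N : ℕ => K * ((M * b) ^ N / N.factorial)) Filter.atTop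
      (nhds 0) := by
    simpa using (FloorSemiring.tendsto_pow_div_factorial_atTop (M * b)).const_mul K
  filter_upwards [hlim.eventually_lt_const hε] with N hN x hx
  have hK0 : 0 ≤ K := (norm_nonneg _).trans (hK x hx)
  have hx0 := hx.1
  rw [dist_eq_norm]
  refine ((hbound N x hx).trans ?_).trans_lt hN
  gcongr
  exact hx.2

/-- The Picard iterates `u_j`, `v_j` sum uniformly on `[0, 2π]` to the fundamental
solutions `c(q;1,·)` and `s(q;1,·)` respectively. -/
theorem picard_series_converge_to_fundamental_solutions
    (q : ℝ → ℂ) (hqcont : Continuous q) (hqbdd : ∃ M : ℝ, ∀ x : ℝ, ‖q x‖ ≤ M)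
    (u v : ℕ → ℝ → ℂ)
    (hu0 : ∀ x : ℝ, u 0 x = (Real.cos x : ℂ))
    (hu : ∀ (j : ℕ) (x : ℝ),
      u (j + 1) x = ∫ t in (0 : ℝ)..x, (Real.sin (x - t) : ℂ) * q t * u j t)
    (hv0 : ∀ x : ℝ, v 0 x = (Real.sin x : ℂ))
    (hv : ∀ (j : ℕ) (x : ℝ),
      v (j + 1) x = ∫ t in (0 : ℝ)..x, (Real.sin (x - t) : ℂ) * q t * v j t)
    (c s : ℝ → ℂ)
    (hc : IsHillSolution q 1 c) (hc0 : c 0 = 1) (hc0' : deriv c 0 = 0)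
    (hs : IsHillSolution q 1 s) (hs0 : s 0 = 0) (hs0' : deriv s 0 = 1) :
    TendstoUniformlyOn (fun N x => ∑ j ∈ Finset.range N, u j x) c
        Filter.atTop (Set.Icc 0 (2 * Real.pi)) ∧
      TendstoUniformlyOn (fun N x => ∑ j ∈ Finset.range N, v j x) s
        Filter.atTop (Set.Icc 0 (2 * Real.pi)) := by
  obtain ⟨M, hM⟩ := hqbdd
  refine ⟨tendstoUniformlyOn_sum_picard hqcont hM hc.1.continuous ?_ hu (fun x => ?_) _,
    tendstoUniformlyOn_sum_picard hqcont hM hs.1.continuous ?_ hv (fun x => ?_) _⟩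
  · rw [funext hu0]
    fun_prop
  · simpa [hu0, hc0, hc0'] using hc.eq_add_integral hqcont x
  · rw [funext hv0]
    fun_prop
  · simpa [hv0, hs0, hs0'] using hs.eq_add_integral hqcont x
end
end

section
/- Let (a_k)_{k≥1} satisfy Σ_{k=1}^∞ |a_k| < ∞, let n ≥ 3 be an integer, set q_n(x) = n² Σ_{k=1}^∞ a_k e^{iknx}, and let c = c(q_n;1,·) be the fundamental solution of −y'' + q_n y = y with c(0) = 1, c'(0) = 0. Then ∫₀^{2π} sin(2π − t) q_n(t) c(t) dt = 0, and consequently c(2π) = 1. -/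
noncomputable section

/-- The exponential `x ↦ e^{imx}` of integer frequency `m`. -/
def expFreq (m : ℤ) (x : ℝ) : ℂ := Complex.exp (Complex.I * m * x)

/-- Trigonometric polynomials with frequencies `k n ± 1`, `k ≥ 0`. -/
def sideSpan (n : ℕ) : Submodule ℂ (ℝ → ℂ) :=
  Submodule.span ℂ {f | ∃ (k : ℕ) (m : ℤ), (m = k * n + 1 ∨ m = k * n - 1) ∧ f = expFreq m}

/-- The solution operator `g ↦ ∫₀ˣ sin(x - t) g(t) dt` of `y'' + y = g`, `y(0) = y'(0) = 0`. -/
def sinVolterra (g : ℝ → ℂ) (x : ℝ) : ℂ :=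
  ∫ t in (0 : ℝ)..x, (Real.sin (x - t) : ℂ) * g t

/-- The truncated potential `n² ∑_{k<N} a_k e^{i(k+1)nx}`. -/
def truncPotential (a : ℕ → ℂ) (n N : ℕ) (x : ℝ) : ℂ :=
  (n : ℂ) ^ 2 * ∑ k ∈ Finset.range N, a k * expFreq ((k + 1) * n) x

lemma expFreq_add (m l : ℤ) (x : ℝ) : expFreq (m + l) x = expFreq m x * expFreq l x := by
  simp only [expFreq, ← Complex.exp_add]
  congr 1
  push_cast
  ring

lemma expFreq_zero_right (m : ℤ) : expFreq m 0 = 1 := by simp [expFreq]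

lemma expFreq_two_pi (m : ℤ) : expFreq m (2 * Real.pi) = 1 := by
  rw [expFreq, Complex.exp_eq_one_iff]
  exact ⟨m, by push_cast; ring⟩

lemma norm_expFreq (m : ℤ) (x : ℝ) : ‖expFreq m x‖ = 1 := by
  rw [expFreq, show Complex.I * (m : ℂ) * (x : ℂ) = ((m * x : ℝ) : ℂ) * Complex.I by
    push_cast; ring]
  exact Complex.norm_exp_ofReal_mul_I _

lemma hasDerivAt_expFreq (m : ℤ) (x : ℝ) :
    HasDerivAt (expFreq m) (Complex.I * m * expFreq m x) x := by
  have h : HasDerivAt (fun x : ℝ => Complex.I * (m : ℂ) * (x : ℂ)) (Complex.I * m * 1) x :=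
    (HasDerivAt.ofReal_comp (hasDerivAt_id x)).const_mul _
  refine h.cexp.congr_deriv ?_
  rw [expFreq]
  ring

lemma continuous_expFreq (m : ℤ) : Continuous (expFreq m) := by
  unfold expFreq
  fun_prop

lemma continuous_truncPotential (a : ℕ → ℂ) (n N : ℕ) : Continuous (truncPotential a n N) := by
  unfold truncPotential
  have := continuous_expFreq
  fun_prop

lemma expFreq_mem_sideSpan {n : ℕ} (k : ℕ) (m : ℤ) (h : m = k * n + 1 ∨ m = k * n - 1) :
    expFreq m ∈ sideSpan n :=
  Submodule.subset_span ⟨k, m, h, rfl⟩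

lemma cos_mem_sideSpan (n : ℕ) : (fun x : ℝ => (Real.cos x : ℂ)) ∈ sideSpan n := by
  have h := (sideSpan n).smul_mem (1 / 2 : ℂ) ((sideSpan n).add_mem
    (expFreq_mem_sideSpan 0 1 (by simp)) (expFreq_mem_sideSpan (n := n) 0 (-1) (by simp)))
  convert h using 1
  ext x
  simp only [Complex.ofReal_cos, Complex.cos, Pi.smul_apply, Pi.add_apply, expFreq, smul_eq_mul]
  push_cast
  ring_nf

lemma sin_mem_sideSpan (n : ℕ) : (fun x : ℝ => (Real.sin x : ℂ)) ∈ sideSpan n := by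
  have h := (sideSpan n).smul_mem (Complex.I / 2 : ℂ) ((sideSpan n).sub_mem
    (expFreq_mem_sideSpan (n := n) 0 (-1) (by simp)) (expFreq_mem_sideSpan 0 1 (by simp)))
  convert h using 1
  ext x
  simp only [Complex.ofReal_sin, Complex.sin, Pi.smul_apply, Pi.sub_apply, expFreq, smul_eq_mul]
  push_cast
  ring_nf

lemma continuous_of_mem_sideSpan {n : ℕ} {p : ℝ → ℂ} (hp : p ∈ sideSpan n) : Continuous p := by
  induction hp using Submodule.span_induction with
  | mem f hf => obtain ⟨k, m, -, rfl⟩ := hf; exact continuous_expFreq m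
  | zero => exact continuous_zero
  | add f g _ _ hf hg => exact hf.add hg
  | smul r f _ hf => exact hf.const_smul r

lemma two_pi_eq_zero_of_mem_sideSpan {n : ℕ} {p : ℝ → ℂ} (hp : p ∈ sideSpan n) :
    p (2 * Real.pi) = p 0 := by
  induction hp using Submodule.span_induction with
  | mem f hf => obtain ⟨k, m, -, rfl⟩ := hf; rw [expFreq_two_pi, expFreq_zero_right]
  | zero => rfl
  | add f g _ _ hf hg => simp [hf, hg]
  | smul r f _ hf => simp [hf]

/-- Variation of constants for `y'' + y = g`. -/
lemma sinVolterra_eq {y y' g : ℝ → ℂ} (hy : ∀ t, HasDerivAt y (y' t) t)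
    (hy' : ∀ t, HasDerivAt y' (g t - y t) t) (hg : Continuous g) (x : ℝ) :
    sinVolterra g x = y x - Real.sin x * y' 0 - Real.cos x * y 0 := by
  have hd : ∀ t : ℝ, HasDerivAt
      (fun t : ℝ => (Real.sin (x - t) : ℂ) * y' t + (Real.cos (x - t) : ℂ) * y t)
      ((Real.sin (x - t) : ℂ) * g t) t := by
    intro t
    have hsub : HasDerivAt (fun t : ℝ => x - t) (-1) t := by
      simpa using (hasDerivAt_id t).const_sub x
    have hs := hsub.sin.ofReal_comp
    have hcs := hsub.cos.ofReal_comp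
    refine ((hs.mul (hy' t)).add (hcs.mul (hy t))).congr_deriv ?_
    push_cast
    ring
  have hcont : Continuous fun t : ℝ => (Real.sin (x - t) : ℂ) * g t := by fun_prop
  rw [sinVolterra, intervalIntegral.integral_eq_sub_of_hasDerivAt (fun t _ => hd t)
    (hcont.intervalIntegrable _ _)]
  simp
  ring

lemma sinVolterra_add {f g : ℝ → ℂ} (hf : Continuous f) (hg : Continuous g) :
    sinVolterra (f + g) = sinVolterra f + sinVolterra g := by
  ext x
  simp only [sinVolterra, Pi.add_apply, mul_add]
  apply intervalIntegral.integral_add <;>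
    exact Continuous.intervalIntegrable (by fun_prop) _ _

lemma sinVolterra_smul (r : ℂ) (f : ℝ → ℂ) : sinVolterra (r • f) = r • sinVolterra f := by
  ext x
  simp only [sinVolterra, Pi.smul_apply, smul_eq_mul, ← intervalIntegral.integral_const_mul]
  congr 1
  ext t
  ring

lemma sinVolterra_sub {f g : ℝ → ℂ} (hf : Continuous f) (hg : Continuous g) :
    sinVolterra (f - g) = sinVolterra f - sinVolterra g := by
  have h := sinVolterra_add hf (hg.const_smul (-1 : ℂ))
  have h2 := sinVolterra_smul (-1) g
  rw [show f - g = f + (-1 : ℂ) • g by simp [sub_eq_add_neg]]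
  rw [show sinVolterra f - sinVolterra g = sinVolterra f + (-1 : ℂ) • sinVolterra g by
    simp [sub_eq_add_neg], ← h2]
  exact h

lemma sinVolterra_expFreq_mem {n k : ℕ} {m : ℤ} (h : m = k * n + 1 ∨ m = k * n - 1)
    (hm : 2 ≤ m) : sinVolterra (expFreq m) ∈ sideSpan n := by
  have hne : (1 - (m : ℂ) ^ 2) ≠ 0 := by
    have : (1 - m ^ 2 : ℤ) ≠ 0 := by nlinarith
    exact_mod_cast this
  have key : ∀ x, sinVolterra (expFreq m) x = (1 - (m : ℂ) ^ 2)⁻¹ * expFreq m x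
      - Real.sin x * ((1 - (m : ℂ) ^ 2)⁻¹ * (Complex.I * m * expFreq m 0))
      - Real.cos x * ((1 - (m : ℂ) ^ 2)⁻¹ * expFreq m 0) := by
    refine sinVolterra_eq (y := fun x => (1 - (m : ℂ) ^ 2)⁻¹ * expFreq m x)
      (y' := fun x => (1 - (m : ℂ) ^ 2)⁻¹ * (Complex.I * m * expFreq m x))
      (fun t => (hasDerivAt_expFreq m t).const_mul _) (fun t => ?_) (continuous_expFreq m)
    refine (((hasDerivAt_expFreq m t).const_mul (Complex.I * (m : ℂ))).const_mul
      (1 - (m : ℂ) ^ 2)⁻¹).congr_deriv ?_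
    field_simp
    rw [Complex.I_sq]
    ring
  have hmem := (sideSpan n).sub_mem ((sideSpan n).sub_mem
    ((sideSpan n).smul_mem (1 - (m : ℂ) ^ 2)⁻¹ (expFreq_mem_sideSpan k m h))
    ((sideSpan n).smul_mem ((1 - (m : ℂ) ^ 2)⁻¹ * (Complex.I * m)) (sin_mem_sideSpan n)))
    ((sideSpan n).smul_mem (1 - (m : ℂ) ^ 2)⁻¹ (cos_mem_sideSpan n))
  convert hmem using 1
  ext x
  rw [key x, expFreq_zero_right]
  simp only [Pi.sub_apply, Pi.smul_apply, smul_eq_mul]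
  ring

lemma sinVolterra_truncPotential_mul_expFreq_mem {n : ℕ} (hn : 3 ≤ n) (a : ℕ → ℂ) (N k : ℕ)
    {m : ℤ} (h : m = k * n + 1 ∨ m = k * n - 1) :
    sinVolterra (truncPotential a n N * expFreq m) ∈ sideSpan n := by
  induction N with
  | zero =>
    convert (sideSpan n).zero_mem
    ext x
    simp [sinVolterra, truncPotential]
  | succ N ih =>
    have hsplit : truncPotential a n (N + 1) * expFreq m = truncPotential a n N * expFreq m +
        ((n : ℂ) ^ 2 * a N) • expFreq (m + (N + 1) * n) := by
      ext x
      simp only [Pi.mul_apply, Pi.add_apply, Pi.smul_apply, smul_eq_mul, truncPotential,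
        Finset.sum_range_succ, expFreq_add]
      ring
    rw [hsplit, sinVolterra_add
      ((continuous_truncPotential a n N).mul (continuous_expFreq m))
      ((continuous_expFreq _).const_smul _), sinVolterra_smul]
    refine (sideSpan n).add_mem ih ((sideSpan n).smul_mem _
      (sinVolterra_expFreq_mem (k := k + N + 1) ?_ ?_))
    · push_cast
      rcases h with rfl | rfl
      · left; ring
      · right; ring
    · have hn' : (3 : ℤ) ≤ n := by exact_mod_cast hn
      have hk : (0 : ℤ) ≤ k * n := by positivity
      have hN : (0 : ℤ) ≤ N * n := by positivity
      rcases h with rfl | rfl <;> nlinarith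

lemma sinVolterra_truncPotential_mul_mem {n : ℕ} (hn : 3 ≤ n) (a : ℕ → ℂ) (N : ℕ)
    {p : ℝ → ℂ} (hp : p ∈ sideSpan n) :
    sinVolterra (truncPotential a n N * p) ∈ sideSpan n := by
  have hQ := continuous_truncPotential a n N
  induction hp using Submodule.span_induction with
  | mem f hf =>
    obtain ⟨k, m, h, rfl⟩ := hf
    exact sinVolterra_truncPotential_mul_expFreq_mem hn a N k h
  | zero =>
    convert (sideSpan n).zero_mem
    ext x
    simp [sinVolterra]
  | add f g hf' hg' hf hg =>
    rw [mul_add, sinVolterra_add (hQ.mul (continuous_of_mem_sideSpan hf'))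
      (hQ.mul (continuous_of_mem_sideSpan hg'))]
    exact (sideSpan n).add_mem hf hg
  | smul r f _ hf =>
    rw [mul_smul_comm, sinVolterra_smul]
    exact (sideSpan n).smul_mem r hf

lemma norm_sinVolterra_le {g : ℝ → ℂ} {A L x : ℝ} (hL : 0 < L) (hA : 0 ≤ A) (hx : 0 ≤ x)
    (h : ∀ t, 0 ≤ t → t ≤ x → ‖g t‖ ≤ A * Real.exp (L * t)) :
    ‖sinVolterra g x‖ ≤ A / L * Real.exp (L * x) := by
  have hint : ∫ t in (0 : ℝ)..x, A * Real.exp (L * t) = A / L * (Real.exp (L * x) - 1) := by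
    have hd : ∀ t ∈ Set.uIcc 0 x,
        HasDerivAt (fun t => A / L * Real.exp (L * t)) (A * Real.exp (L * t)) t := by
      intro t _
      refine ((((hasDerivAt_id t).const_mul L).exp).const_mul (A / L)).congr_deriv ?_
      field_simp
      rw [id]
    rw [intervalIntegral.integral_eq_sub_of_hasDerivAt hd
      (Continuous.intervalIntegrable (by fun_prop) _ _)]
    simp
    ring
  calc ‖sinVolterra g x‖ ≤ ∫ t in (0 : ℝ)..x, A * Real.exp (L * t) := by
        refine intervalIntegral.norm_integral_le_of_norm_le hx
          (Filter.Eventually.of_forall fun t ht => ?_)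
          (Continuous.intervalIntegrable (by fun_prop) _ _)
        rw [norm_mul, Complex.norm_real, Real.norm_eq_abs]
        exact (mul_le_of_le_one_left (norm_nonneg _) (Real.abs_sin_le_one _)).trans
          (h t ht.1.le ht.2)
    _ ≤ A / L * Real.exp (L * x) := by
        rw [hint]
        exact mul_le_mul_of_nonneg_left (by linarith) (by positivity)

/-- Picard iterates for a truncated potential stay in `sideSpan n` and approximate solutions of
the integral equation with the full potential. -/
lemma exists_mem_sideSpan_approx {n : ℕ} (hn : 3 ≤ n) (a : ℕ → ℂ) (N : ℕ) {q c : ℝ → ℂ}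
    (hq : Continuous q) (hc : Continuous c) {K C ε X : ℝ} (hK : 1 ≤ K) (hε : 0 ≤ ε)
    (hC0 : 0 ≤ C) (hQK : ∀ x, ‖truncPotential a n N x‖ ≤ K)
    (hqQ : ∀ x, ‖q x - truncPotential a n N x‖ ≤ ε)
    (hC : ∀ x, 0 ≤ x → x ≤ X → ‖c x‖ ≤ C)
    (hVolt : ∀ x, c x = Real.cos x + sinVolterra (q * c) x) (j : ℕ) :
    ∃ p ∈ sideSpan n, ∀ x, 0 ≤ x → x ≤ X →
      ‖c x - p x‖ ≤ (ε * C + C / 2 ^ j) * Real.exp (2 * K * x) := by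
  have hQ := continuous_truncPotential a n N
  have hexp : ∀ x : ℝ, 0 ≤ x → 1 ≤ Real.exp (2 * K * x) := fun x hx =>
    Real.one_le_exp (by positivity)
  induction j with
  | zero =>
    refine ⟨0, (sideSpan n).zero_mem, fun x hx hX => ?_⟩
    have h1 := hexp x hx
    have h2 : 0 ≤ ε * C := by positivity
    simp only [Pi.zero_apply, sub_zero, pow_zero, div_one]
    nlinarith [hC x hx hX]
  | succ j ih =>
    obtain ⟨p, hp, hpc⟩ := ih
    have hpcont := continuous_of_mem_sideSpan hp
    refine ⟨(fun x : ℝ => (Real.cos x : ℂ)) + sinVolterra (truncPotential a n N * p),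
      (sideSpan n).add_mem (cos_mem_sideSpan n) (sinVolterra_truncPotential_mul_mem hn a N hp),
      fun x hx hX => ?_⟩
    have hdiff : c x - ((fun x : ℝ => (Real.cos x : ℂ)) +
        sinVolterra (truncPotential a n N * p)) x =
        sinVolterra (q * c - truncPotential a n N * p) x := by
      rw [sinVolterra_sub (hq.mul hc) (hQ.mul hpcont), hVolt x]
      simp only [Pi.add_apply, Pi.sub_apply]
      ring
    rw [hdiff]
    have hbound := norm_sinVolterra_le (g := q * c - truncPotential a n N * p)
      (A := ε * C + K * (ε * C + C / 2 ^ j)) (L := 2 * K) (x := x) (by positivity)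
      (by positivity) hx (fun t ht0 htx => by
        have h1 := hexp t ht0
        have e : (q * c - truncPotential a n N * p) t = (q t - truncPotential a n N t) * c t +
            truncPotential a n N t * (c t - p t) := by
          simp only [Pi.sub_apply, Pi.mul_apply]
          ring
        rw [e]
        calc _ ≤ ‖q t - truncPotential a n N t‖ * ‖c t‖ +
              ‖truncPotential a n N t‖ * ‖c t - p t‖ := by
              simpa only [norm_mul] using norm_add_le
                ((q t - truncPotential a n N t) * c t) (truncPotential a n N t * (c t - p t))
          _ ≤ ε * C + K * ((ε * C + C / 2 ^ j) * Real.exp (2 * K * t)) := by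
              gcongr
              · exact hqQ t
              · exact hC t ht0 (htx.trans hX)
              · exact hQK t
              · exact hpc t ht0 (htx.trans hX)
          _ ≤ ε * C * Real.exp (2 * K * t) +
              K * ((ε * C + C / 2 ^ j) * Real.exp (2 * K * t)) := by
              exact add_le_add_left (le_mul_of_one_le_right (by positivity) h1) _
          _ = _ := by ring)
    refine hbound.trans (mul_le_mul_of_nonneg_right ?_ (Real.exp_pos _).le)
    rw [div_le_iff₀ (by positivity), pow_succ]
    have h2 : 0 ≤ ε * C * (K - 1) := mul_nonneg (by positivity) (by linarith)
    have h3 : C / (2 ^ j * 2) * (2 * K) = K * (C / 2 ^ j) := by field_simp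
    rw [add_mul, h3]
    nlinarith

/-- For `qₙ(x) = n² ∑_{k=1}^∞ a_k e^{iknx}` with `∑|a_k| < ∞` and `n ≥ 3`, the fundamental
solution `c = c(qₙ;1,·)` satisfies `∫₀^{2π} sin(2π - t) qₙ(t) c(t) dt = 0` and `c(2π) = 1`. -/
theorem integral_vanishes_and_c_two_pi
    (a : ℕ → ℂ) (ha : Summable fun k => ‖a k‖)
    (n : ℕ) (hn : 3 ≤ n)
    (qn : ℝ → ℂ)
    (hq : ∀ x : ℝ, qn x =
      (n : ℂ) ^ 2 * ∑' k : ℕ, a k * Complex.exp (Complex.I * (((k : ℂ) + 1) * n) * (x : ℂ)))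
    (c : ℝ → ℂ)
    (hc : IsHillSolution qn 1 c) (hc0 : c 0 = 1) (hc0' : deriv c 0 = 0) :
    (∫ t in (0 : ℝ)..(2 * Real.pi), (Real.sin (2 * Real.pi - t) : ℂ) * qn t * c t) = 0 ∧
      c (2 * Real.pi) = 1 := by
  have hq' : ∀ x, qn x = (n : ℂ) ^ 2 * ∑' k : ℕ, a k * expFreq ((k + 1) * n) x := by
    intro x
    rw [hq x]
    simp [expFreq]
  have hnorm : ∀ k x, ‖a k * expFreq ((k + 1) * n) x‖ = ‖a k‖ := fun k x => by
    rw [norm_mul, norm_expFreq, mul_one]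
  have hsum : ∀ x, Summable fun k : ℕ => a k * expFreq ((k + 1) * n) x := fun x =>
    Summable.of_norm (by simpa only [hnorm] using ha)
  have hqcont : Continuous qn := by
    rw [funext hq']
    exact continuous_const.mul (continuous_tsum
      (fun k => continuous_const.mul (continuous_expFreq _)) ha fun k x => (hnorm k x).le)
  obtain ⟨hcd, hcd', hode⟩ := hc
  have hVolt : ∀ x, c x = Real.cos x + sinVolterra (qn * c) x := by
    intro x
    rw [sinVolterra_eq (y := c) (y' := deriv c) (fun t => (hcd t).hasDerivAt) (fun t => ?_)
      (hqcont.mul hcd.continuous) x, hc0, hc0']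
    · ring
    · refine (hcd' t).hasDerivAt.congr_deriv ?_
      simp only [Pi.mul_apply]
      linear_combination -hode t
  obtain ⟨C, hC⟩ := (isCompact_Icc (a := (0 : ℝ)) (b := 2 * Real.pi)).exists_bound_of_continuousOn
    hcd.continuous.continuousOn
  have hpi := Real.two_pi_pos
  have hC0 : 0 ≤ C := (norm_nonneg _).trans (hC 0 ⟨le_rfl, hpi.le⟩)
  set K : ℝ := n ^ 2 * (∑' k, ‖a k‖) + 1 with hK
  have hsum0 : 0 ≤ ∑' k, ‖a k‖ := tsum_nonneg fun _ => norm_nonneg _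
  have hK1 : 1 ≤ K := by
    rw [hK]
    have : 0 ≤ (n : ℝ) ^ 2 * ∑' k, ‖a k‖ := by positivity
    linarith
  set ε : ℕ → ℝ := fun N => n ^ 2 * ∑' k, ‖a (k + N)‖ with hε
  have hε0 : ∀ N, 0 ≤ ε N := fun N =>
    mul_nonneg (by positivity) (tsum_nonneg fun _ => norm_nonneg _)
  have hQK : ∀ N x, ‖truncPotential a n N x‖ ≤ K := by
    intro N x
    rw [truncPotential, norm_mul, norm_pow, Complex.norm_natCast, hK]
    have h1 : ‖∑ k ∈ Finset.range N, a k * expFreq ((k + 1) * n) x‖ ≤ ∑' k, ‖a k‖ := by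
      refine (norm_sum_le _ _).trans ?_
      simp only [hnorm]
      exact ha.sum_le_tsum _ fun _ _ => norm_nonneg _
    have := mul_le_mul_of_nonneg_left h1 (by positivity : (0 : ℝ) ≤ (n : ℝ) ^ 2)
    linarith
  have hqQ : ∀ N x, ‖qn x - truncPotential a n N x‖ ≤ ε N := by
    intro N x
    rw [hq' x, truncPotential, ← mul_sub, ← (hsum x).sum_add_tsum_nat_add N, add_sub_cancel_left,
      norm_mul, norm_pow, Complex.norm_natCast]
    refine mul_le_mul_of_nonneg_left ?_ (by positivity)
    exact tsum_of_norm_bounded ((summable_nat_add_iff N).2 ha).hasSum fun k => (hnorm (k + N) x).le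
  have hle : ∀ N : ℕ, ‖c (2 * Real.pi) - 1‖ ≤
      2 * ((ε N * C + C / 2 ^ N) * Real.exp (2 * K * (2 * Real.pi))) := by
    intro N
    obtain ⟨p, hp, hpc⟩ := exists_mem_sideSpan_approx hn a N hqcont hcd.continuous hK1 (hε0 N)
      hC0 (hQK N) (hqQ N) (fun x h0 hX => hC x ⟨h0, hX⟩) hVolt N
    have h1 := hpc _ hpi.le le_rfl
    have h2 := hpc 0 le_rfl hpi.le
    have h3 : Real.exp (2 * K * 0) ≤ Real.exp (2 * K * (2 * Real.pi)) := by gcongr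
    have h4 : 0 ≤ ε N * C + C / 2 ^ N := by have := hε0 N; positivity
    have h5 := mul_le_mul_of_nonneg_left h3 h4
    have h6 : c (2 * Real.pi) - 1 = (c (2 * Real.pi) - p (2 * Real.pi)) - (c 0 - p 0) := by
      rw [two_pi_eq_zero_of_mem_sideSpan hp, hc0]
      ring
    rw [h6]
    linarith [norm_sub_le (c (2 * Real.pi) - p (2 * Real.pi)) (c 0 - p 0)]
  have hlim : Filter.Tendsto
      (fun N : ℕ => 2 * ((ε N * C + C / 2 ^ N) * Real.exp (2 * K * (2 * Real.pi))))
      Filter.atTop (nhds 0) := by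
    have h1 : Filter.Tendsto ε Filter.atTop (nhds 0) := by
      simpa using (tendsto_sum_nat_add fun k => ‖a k‖).const_mul ((n : ℝ) ^ 2)
    have h2 : Filter.Tendsto (fun N : ℕ => C / 2 ^ N) Filter.atTop (nhds 0) :=
      Filter.Tendsto.const_div_atTop (tendsto_pow_atTop_atTop_of_one_lt one_lt_two) C
    simpa using (((h1.mul_const C).add h2).mul_const
      (Real.exp (2 * K * (2 * Real.pi)))).const_mul 2
  have hfin : c (2 * Real.pi) = 1 :=
    sub_eq_zero.1 (norm_le_zero_iff.1 (ge_of_tendsto' hlim hle))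
  refine ⟨?_, hfin⟩
  have h := hVolt (2 * Real.pi)
  rw [hfin, Real.cos_two_pi, sinVolterra] at h
  simpa [mul_assoc] using h
end
end

section
/- Let (a_k)_{k≥1} satisfy Σ_{k=1}^∞ |a_k| < ∞, let n ≥ 3 be an integer, set q_n(x) = n² Σ_{k=1}^∞ a_k e^{iknx}, and let s = s(q_n;1,·) be the fundamental solution of −y'' + q_n y = y with s(0) = 0, s'(0) = 1. Then ∫₀^{2π} cos(2π − t) q_n(t) s(t) dt = 0, and consequently s'(2π) = 1. -/
noncomputable section

/-- The trigonometric series `∑ c_k e^{i ν_k x}`. -/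
def trigSeries (ν : ℕ → ℝ) (c : ℕ → ℂ) (x : ℝ) : ℂ :=
  ∑' k, c k * Complex.exp (Complex.I * ν k * x)

theorem norm_exp_I_mul_mul (ν x : ℝ) : ‖Complex.exp (Complex.I * ν * x)‖ = 1 := by
  rw [mul_assoc, mul_comm, ← Complex.ofReal_mul, Complex.norm_exp_ofReal_mul_I]

theorem norm_trigSeries_term (ν : ℕ → ℝ) (c : ℕ → ℂ) (x : ℝ) (k : ℕ) :
    ‖c k * Complex.exp (Complex.I * ν k * x)‖ = ‖c k‖ := by
  rw [norm_mul, norm_exp_I_mul_mul, mul_one]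

theorem summable_norm_trigSeries {ν : ℕ → ℝ} {c : ℕ → ℂ} (hc : Summable fun k => ‖c k‖)
    (x : ℝ) : Summable fun k => ‖c k * Complex.exp (Complex.I * ν k * x)‖ := by
  simpa only [norm_trigSeries_term] using hc

theorem hasDerivAt_trigSeries {ν : ℕ → ℝ} {c : ℕ → ℂ} (hc : Summable fun k => ‖c k‖)
    (hνc : Summable fun k => ‖Complex.I * ν k * c k‖) (x : ℝ) :
    HasDerivAt (trigSeries ν c) (trigSeries ν (fun k => Complex.I * ν k * c k) x) x := by
  refine hasDerivAt_tsum (𝕜 := ℝ) (g := fun k (x : ℝ) => c k * Complex.exp (Complex.I * ν k * x))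
    (g' := fun k (x : ℝ) => Complex.I * ν k * c k * Complex.exp (Complex.I * ν k * x)) hνc
    (fun k y => ?_) (fun k y => ?_) (summable_norm_trigSeries hc 0).of_norm x
  · have h := (((Complex.ofRealCLM.hasDerivAt (x := y)).const_mul
      (Complex.I * ν k)).cexp).const_mul (c k)
    refine h.congr_deriv ?_
    simp
    ring
  · exact (norm_trigSeries_term ν (fun k => Complex.I * ν k * c k) y k).le

/-- A quasi-periodicity property of series whose frequencies differ by multiples of `n`. -/
theorem trigSeries_add {μ : ℝ} {n : ℕ} (c : ℕ → ℂ) {T : ℝ}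
    (hT : Complex.exp (Complex.I * n * T) = 1) (x : ℝ) :
    trigSeries (fun k => μ + k * n) c (x + T) =
      Complex.exp (Complex.I * μ * T) * trigSeries (fun k => μ + k * n) c x := by
  unfold trigSeries
  rw [← tsum_mul_left]
  refine tsum_congr fun k => ?_
  have h : Complex.exp (Complex.I * ((μ + k * n : ℝ) : ℂ) * ((x + T : ℝ) : ℂ)) =
      Complex.exp (Complex.I * ((μ + k * n : ℝ) : ℂ) * x) * Complex.exp (Complex.I * μ * T) *
        Complex.exp (Complex.I * n * T) ^ k := by
    rw [← Complex.exp_nat_mul, ← Complex.exp_add, ← Complex.exp_add]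
    congr 1
    push_cast
    ring
  rw [h, hT]
  ring

theorem trigSeries_ne_zero {μ : ℝ} {n : ℕ} (hn : n ≠ 0) {c : ℕ → ℂ}
    (hc : Summable fun k => ‖c k‖) (hc0 : c 0 ≠ 0) :
    trigSeries (fun k => μ + k * n) c ≠ 0 := by
  intro h
  have hzero (x : ℝ) : trigSeries (fun k => (k * n : ℝ)) c x = 0 := by
    have h' : trigSeries (fun k => (k * n : ℝ)) c x =
        Complex.exp (-(Complex.I * μ * x)) * trigSeries (fun k => μ + k * n) c x := by
      unfold trigSeries
      rw [← tsum_mul_left]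
      refine tsum_congr fun k => ?_
      rw [mul_left_comm, ← Complex.exp_add]
      congr 2
      push_cast
      ring
    rw [h', h, Pi.zero_apply, mul_zero]
  let F : ℕ → C(ℝ, ℂ) := fun k =>
    ⟨fun x => c k * Complex.exp (Complex.I * ((k * n : ℝ) : ℂ) * x), by fun_prop⟩
  have hF : Summable fun k =>
      ‖(F k).restrict (⟨Set.uIcc 0 (2 * Real.pi), isCompact_uIcc⟩ :
        TopologicalSpace.Compacts ℝ)‖ := by
    refine Summable.of_nonneg_of_le (fun _ => norm_nonneg _) (fun k => ?_) hc
    refine (ContinuousMap.norm_le _ (norm_nonneg _)).2 fun x => ?_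
    exact (norm_trigSeries_term (fun k => (k * n : ℝ)) c x k).le
  have hsum := intervalIntegral.hasSum_intervalIntegral_of_summable_norm hF
  have hint : (∫ x in (0 : ℝ)..(2 * Real.pi), ∑' k, F k x) = 0 :=
    intervalIntegral.integral_zero_ae (Filter.Eventually.of_forall fun x _ => hzero x)
  have hterm (k : ℕ) (hk : k ≠ 0) : (∫ x in (0 : ℝ)..(2 * Real.pi), F k x) = 0 := by
    have hk' : Complex.I * ((k * n : ℝ) : ℂ) ≠ 0 := by
      simp [hk, hn]
    have hper : Complex.exp (Complex.I * ((k * n : ℝ) : ℂ) * ((2 * Real.pi : ℝ) : ℂ)) = 1 := by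
      rw [Complex.exp_eq_one_iff]
      exact ⟨k * n, by push_cast; ring⟩
    change (∫ x in (0 : ℝ)..(2 * Real.pi),
      c k * Complex.exp (Complex.I * ((k * n : ℝ) : ℂ) * x)) = 0
    rw [intervalIntegral.integral_const_mul, integral_exp_mul_complex hk', hper]
    simp
  rw [hint] at hsum
  have h0 := hsum.unique (hasSum_single 0 hterm)
  simp [F, hc0, Real.pi_ne_zero] at h0

/-- Coefficients of the Floquet solution `∑ c_k e^{i(μ + kn)x}`, normalised by `c_0 = 1`, for the
potential `∑ b_k e^{i(k+1)nx}`. -/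
def floquetCoeff (b : ℕ → ℂ) (μ : ℝ) (n : ℕ) : ℕ → ℂ
  | 0 => 1
  | k + 1 => (∑ l : Fin (k + 1), b (k - l) * floquetCoeff b μ n l) /
      (1 - ((μ + ((k + 1 : ℕ) : ℝ) * n : ℝ) : ℂ) ^ 2)

theorem floquetCoeff_zero (b : ℕ → ℂ) (μ : ℝ) (n : ℕ) : floquetCoeff b μ n 0 = 1 := by
  rw [floquetCoeff]

theorem floquetCoeff_succ (b : ℕ → ℂ) (μ : ℝ) (n k : ℕ) :
    floquetCoeff b μ n (k + 1) =
      (∑ p ∈ Finset.HasAntidiagonal.antidiagonal k, b p.1 * floquetCoeff b μ n p.2) /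
        (1 - ((μ + ((k + 1 : ℕ) : ℝ) * n : ℝ) : ℂ) ^ 2) := by
  rw [floquetCoeff, Fin.sum_univ_eq_sum_range (fun l => b (k - l) * floquetCoeff b μ n l),
    ← Finset.Nat.sum_antidiagonal_eq_sum_range_succ (fun i j => b j * floquetCoeff b μ n i),
    ← Finset.Nat.sum_antidiagonal_swap]
  rfl

theorem sq_le_norm_one_sub_frequency_sq {μ : ℝ} (hμ : |μ| = 1) {n : ℕ} (hn : 3 ≤ n) (k : ℕ) :
    ((k : ℝ) + 1) ^ 2 ≤ ‖1 - ((μ + ((k + 1 : ℕ) : ℝ) * n : ℝ) : ℂ) ^ 2‖ := by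
  have hn' : (3 : ℝ) ≤ n := by exact_mod_cast hn
  have hk : (0 : ℝ) ≤ k := k.cast_nonneg
  have hnorm : ‖1 - ((μ + ((k + 1 : ℕ) : ℝ) * n : ℝ) : ℂ) ^ 2‖ =
      |1 - (μ + ((k + 1 : ℕ) : ℝ) * n) ^ 2| := by
    rw [← Real.norm_eq_abs, ← Complex.norm_real]
    push_cast
    rfl
  rw [hnorm, abs_sub_comm]
  refine le_trans ?_ (le_abs_self _)
  push_cast
  have h1 : ((k : ℝ) + 1) * 3 ≤ (k + 1) * n := by gcongr
  have hμ' : -1 ≤ μ := (abs_le.1 hμ.le).1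
  nlinarith

theorem one_sub_frequency_sq_ne_zero {μ : ℝ} (hμ : |μ| = 1) {n : ℕ} (hn : 3 ≤ n) (k : ℕ) :
    (1 - ((μ + ((k + 1 : ℕ) : ℝ) * n : ℝ) : ℂ) ^ 2) ≠ 0 := by
  rw [← norm_pos_iff]
  exact lt_of_lt_of_le (by positivity) (sq_le_norm_one_sub_frequency_sq hμ hn k)

theorem norm_floquetCoeff_succ_le {b : ℕ → ℂ} (hb : Summable fun k => ‖b k‖) {μ : ℝ}
    (hμ : |μ| = 1) {n : ℕ} (hn : 3 ≤ n) {k : ℕ} {M : ℝ} (hM : 0 ≤ M)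
    (h : ∀ l ≤ k, ‖floquetCoeff b μ n l‖ ≤ M) :
    ‖floquetCoeff b μ n (k + 1)‖ ≤ (∑' j, ‖b j‖) * M / ((k : ℝ) + 1) ^ 2 := by
  rw [floquetCoeff_succ, norm_div]
  refine div_le_div₀ (mul_nonneg (tsum_nonneg fun _ => norm_nonneg _) hM) ?_ (by positivity)
    (sq_le_norm_one_sub_frequency_sq hμ hn k)
  calc ‖∑ p ∈ Finset.HasAntidiagonal.antidiagonal k, b p.1 * floquetCoeff b μ n p.2‖
      ≤ ∑ p ∈ Finset.HasAntidiagonal.antidiagonal k, ‖b p.1‖ * M := by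
        refine norm_sum_le_of_le _ fun p hp => ?_
        rw [norm_mul]
        gcongr
        exact h _ (by simp [← Finset.HasAntidiagonal.mem_antidiagonal.1 hp])
    _ = (∑ j ∈ Finset.range (k + 1), ‖b j‖) * M := by
        rw [Finset.Nat.sum_antidiagonal_eq_sum_range_succ (fun i _ => ‖b i‖ * M),
          Finset.sum_mul]
    _ ≤ (∑' j, ‖b j‖) * M := by
        gcongr
        exact hb.sum_le_tsum _ fun _ _ => norm_nonneg _

theorem exists_norm_floquetCoeff_le {b : ℕ → ℂ} (hb : Summable fun k => ‖b k‖) {μ : ℝ}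
    (hμ : |μ| = 1) {n : ℕ} (hn : 3 ≤ n) :
    ∃ M, 0 ≤ M ∧ ∀ k, ‖floquetCoeff b μ n k‖ ≤ M := by
  obtain ⟨K, hK⟩ := exists_nat_ge (∑' j, ‖b j‖)
  have hM : 0 ≤ ∑ l ∈ Finset.range (K + 1), ‖floquetCoeff b μ n l‖ :=
    Finset.sum_nonneg fun _ _ => norm_nonneg _
  refine ⟨_, hM, fun k => ?_⟩
  induction k using Nat.strong_induction_on with
  | _ k ih =>
    rcases lt_or_ge k (K + 1) with hk | hk
    · exact Finset.single_le_sum (f := fun l => ‖floquetCoeff b μ n l‖)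
        (fun _ _ => norm_nonneg _) (Finset.mem_range.2 hk)
    · obtain ⟨m, rfl⟩ : ∃ m, k = m + 1 := ⟨k - 1, by omega⟩
      refine (norm_floquetCoeff_succ_le hb hμ hn hM fun l hl => ih l (by omega)).trans ?_
      rw [div_le_iff₀ (by positivity), mul_comm]
      have hKm : (K : ℝ) ≤ m := by exact_mod_cast Nat.le_of_succ_le_succ hk
      have hm : (0 : ℝ) ≤ m := m.cast_nonneg
      gcongr
      nlinarith

theorem summable_norm_floquetCoeff {b : ℕ → ℂ} (hb : Summable fun k => ‖b k‖) {μ : ℝ}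
    (hμ : |μ| = 1) {n : ℕ} (hn : 3 ≤ n) : Summable fun k => ‖floquetCoeff b μ n k‖ := by
  obtain ⟨M, hM, h⟩ := exists_norm_floquetCoeff_le hb hμ hn
  rw [← summable_nat_add_iff 1]
  refine Summable.of_nonneg_of_le (fun _ => norm_nonneg _)
    (fun k => norm_floquetCoeff_succ_le hb hμ hn hM fun l _ => h l) ?_
  have := ((summable_nat_add_iff 1).2 (Real.summable_one_div_nat_pow.2 one_lt_two)).mul_left
    ((∑' j, ‖b j‖) * M)
  simpa [div_eq_mul_inv] using this

theorem frequency_sq_mul_floquetCoeff_succ (b : ℕ → ℂ) {μ : ℝ} (hμ : |μ| = 1) {n : ℕ}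
    (hn : 3 ≤ n) (k : ℕ) :
    ((μ + ((k + 1 : ℕ) : ℝ) * n : ℝ) : ℂ) ^ 2 * floquetCoeff b μ n (k + 1) =
      floquetCoeff b μ n (k + 1) -
        ∑ p ∈ Finset.HasAntidiagonal.antidiagonal k, b p.1 * floquetCoeff b μ n p.2 := by
  have h := floquetCoeff_succ b μ n k
  rw [eq_div_iff (one_sub_frequency_sq_ne_zero hμ hn k)] at h
  rw [← h]
  ring

theorem summable_norm_frequency_sq_mul_floquetCoeff {b : ℕ → ℂ} (hb : Summable fun k => ‖b k‖)
    {μ : ℝ} (hμ : |μ| = 1) {n : ℕ} (hn : 3 ≤ n) :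
    Summable fun k : ℕ => ‖((μ + k * n : ℝ) : ℂ) ^ 2 * floquetCoeff b μ n k‖ := by
  have hc := summable_norm_floquetCoeff hb hμ hn
  rw [← summable_nat_add_iff 1]
  simp only [frequency_sq_mul_floquetCoeff_succ b hμ hn]
  exact Summable.of_nonneg_of_le (fun _ => norm_nonneg _) (fun _ => norm_sub_le _ _)
    (((summable_nat_add_iff 1).2 hc).add
      (summable_norm_sum_mul_antidiagonal_of_summable_norm hb hc))

theorem summable_norm_frequency_mul_floquetCoeff {b : ℕ → ℂ} (hb : Summable fun k => ‖b k‖)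
    {μ : ℝ} (hμ : |μ| = 1) {n : ℕ} (hn : 3 ≤ n) :
    Summable fun k : ℕ => ‖Complex.I * ((μ + k * n : ℝ) : ℂ) * floquetCoeff b μ n k‖ := by
  refine Summable.of_nonneg_of_le (fun _ => norm_nonneg _) (fun k => ?_)
    ((summable_norm_floquetCoeff hb hμ hn).add
      (summable_norm_frequency_sq_mul_floquetCoeff hb hμ hn))
  simp only [norm_mul, norm_pow, Complex.norm_I, one_mul]
  nlinarith [norm_nonneg (floquetCoeff b μ n k), norm_nonneg ((μ + k * n : ℝ) : ℂ),
    mul_nonneg (norm_nonneg (floquetCoeff b μ n k)) (sq_nonneg (‖((μ + k * n : ℝ) : ℂ)‖ - 1)),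
    mul_nonneg (norm_nonneg (floquetCoeff b μ n k)) (sq_nonneg (‖((μ + k * n : ℝ) : ℂ)‖))]

/-- The Floquet solution with exponent `μ`. -/
def floquetSolution (b : ℕ → ℂ) (μ : ℝ) (n : ℕ) : ℝ → ℂ :=
  trigSeries (fun k => μ + k * n) (floquetCoeff b μ n)

theorem isHillSolution_floquetSolution {b : ℕ → ℂ} (hb : Summable fun k => ‖b k‖) {μ : ℝ}
    (hμ : |μ| = 1) {n : ℕ} (hn : 3 ≤ n) :
    IsHillSolution (trigSeries (fun k => (k + 1) * n) b) 1 (floquetSolution b μ n) := by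
  have hc := summable_norm_floquetCoeff hb hμ hn
  have hc1 := summable_norm_frequency_mul_floquetCoeff hb hμ hn
  have hc2 : Summable fun k : ℕ => ‖Complex.I * ((μ + k * n : ℝ) : ℂ) *
      (Complex.I * ((μ + k * n : ℝ) : ℂ) * floquetCoeff b μ n k)‖ := by
    convert summable_norm_frequency_sq_mul_floquetCoeff hb hμ hn using 2 with k
    simp only [norm_mul, norm_pow, Complex.norm_I, one_mul]
    ring
  have hd1 := hasDerivAt_trigSeries (ν := fun k => μ + k * n) hc hc1
  have hd2 := hasDerivAt_trigSeries (ν := fun k => μ + k * n) hc1 hc2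
  have hderiv : deriv (floquetSolution b μ n) = _ := funext fun x => (hd1 x).deriv
  refine ⟨fun x => (hd1 x).differentiableAt, ?_, fun x => ?_⟩
  · rw [hderiv]
    exact fun x => (hd2 x).differentiableAt
  · rw [hderiv, (hd2 x).deriv]
    have hprod := tsum_mul_tsum_eq_tsum_sum_antidiagonal_of_summable_norm
      (summable_norm_trigSeries (ν := fun k => (k + 1) * n) hb x)
      (summable_norm_trigSeries (ν := fun k => μ + k * n) hc x)
    have hs := (summable_norm_trigSeries (ν := fun k => μ + k * n) hc x).of_norm
    have hs2 := (summable_norm_trigSeries (ν := fun k => μ + k * n) hc2 x).of_norm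
    have hμ2 : (μ : ℂ) ^ 2 = 1 := by
      have : μ ^ 2 = 1 := by rw [← sq_abs, hμ, one_pow]
      exact_mod_cast this
    rw [one_mul]
    unfold floquetSolution
    unfold trigSeries
    rw [hprod, neg_add_eq_iff_eq_add, ← hs2.tsum_add hs, (hs2.add hs).tsum_eq_zero_add]
    have h0 : Complex.I * ((μ + (0 : ℕ) * n : ℝ) : ℂ) *
      (Complex.I * ((μ + (0 : ℕ) * n : ℝ) : ℂ) * floquetCoeff b μ n 0) *
        Complex.exp (Complex.I * ((μ + (0 : ℕ) * n : ℝ) : ℂ) * x) +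
      floquetCoeff b μ n 0 * Complex.exp (Complex.I * ((μ + (0 : ℕ) * n : ℝ) : ℂ) * x) = 0 := by
      simp only [Nat.cast_zero, zero_mul, add_zero]
      linear_combination (floquetCoeff b μ n 0 * Complex.exp (Complex.I * μ * x)) *
        ((μ : ℂ) ^ 2 * Complex.I_sq - hμ2)
    rw [h0, zero_add]
    refine tsum_congr fun k => ?_
    have hk : ∑ p ∈ Finset.HasAntidiagonal.antidiagonal k,
        b p.1 * Complex.exp (Complex.I * (((p.1 + 1) * n : ℝ) : ℂ) * x) *
          (floquetCoeff b μ n p.2 * Complex.exp (Complex.I * ((μ + p.2 * n : ℝ) : ℂ) * x)) =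
        (∑ p ∈ Finset.HasAntidiagonal.antidiagonal k, b p.1 * floquetCoeff b μ n p.2) *
          Complex.exp (Complex.I * ((μ + ((k + 1 : ℕ) : ℝ) * n : ℝ) : ℂ) * x) := by
      rw [Finset.sum_mul]
      refine Finset.sum_congr rfl fun p hp => ?_
      rw [Finset.HasAntidiagonal.mem_antidiagonal] at hp
      rw [mul_mul_mul_comm, ← Complex.exp_add, ← hp]
      congr 2
      push_cast
      ring
    rw [hk]
    have h := frequency_sq_mul_floquetCoeff_succ b hμ hn k
    generalize Complex.exp (Complex.I * ((μ + ((k + 1 : ℕ) : ℝ) * n : ℝ) : ℂ) * x) = E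
    generalize ((μ + ((k + 1 : ℕ) : ℝ) * n : ℝ) : ℂ) = w at *
    linear_combination E * h - E * w ^ 2 * floquetCoeff b μ n (k + 1) * Complex.I_sq

namespace IsHillSolution

variable {q : ℝ → ℂ} {z : ℂ} {f g : ℝ → ℂ}

theorem deriv_linearCombination (hf : IsHillSolution q z f) (hg : IsHillSolution q z g)
    (α β : ℂ) :
    deriv (fun x => α * f x + β * g x) = fun x => α * deriv f x + β * deriv g x :=
  funext fun x =>
    (((hf.1 x).hasDerivAt.const_mul α).add ((hg.1 x).hasDerivAt.const_mul β)).deriv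

theorem linearCombination (hf : IsHillSolution q z f) (hg : IsHillSolution q z g) (α β : ℂ) :
    IsHillSolution q z fun x => α * f x + β * g x := by
  have h2 (x : ℝ) := ((hf.2.1 x).hasDerivAt.const_mul α).add ((hg.2.1 x).hasDerivAt.const_mul β)
  have hd := hf.deriv_linearCombination hg α β
  refine ⟨(hf.1.const_mul α).add (hg.1.const_mul β), ?_, fun x => ?_⟩
  · rw [hd]
    exact fun x => (h2 x).differentiableAt
  · rw [hd, show deriv (fun x => α * deriv f x + β * deriv g x) x = _ from (h2 x).deriv]
    linear_combination α * hf.2.2 x + β * hg.2.2 x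

/-- Uniqueness for the Cauchy problem at the origin. -/
theorem eq_of_cauchyData (hf : IsHillSolution q z f) (hg : IsHillSolution q z g) {C : ℝ}
    (hq : ∀ x, ‖q x‖ ≤ C) (h0 : f 0 = g 0) (h0' : deriv f 0 = deriv g 0) : f = g := by
  let v : ℝ → ℂ × ℂ → ℂ × ℂ := fun t p => (p.2, (q t - z) * p.1)
  have hC : 0 ≤ C := (norm_nonneg _).trans (hq 0)
  have hv (t : ℝ) : LipschitzOnWith (1 + C + ‖z‖).toNNReal (v t) Set.univ := by
    rw [lipschitzOnWith_univ]
    refine LipschitzWith.of_dist_le' fun p r => ?_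
    have h1 : ‖p.1 - r.1‖ ≤ ‖p - r‖ := norm_fst_le (p - r)
    have h2 : ‖p.2 - r.2‖ ≤ ‖p - r‖ := norm_snd_le (p - r)
    rw [dist_eq_norm, dist_eq_norm, Prod.norm_def]
    refine max_le ?_ ?_
    · change ‖p.2 - r.2‖ ≤ _
      nlinarith [norm_nonneg (p - r), norm_nonneg z, mul_nonneg hC (norm_nonneg (p - r)),
        mul_nonneg (norm_nonneg z) (norm_nonneg (p - r))]
    · change ‖(q t - z) * p.1 - (q t - z) * r.1‖ ≤ _
      rw [← mul_sub, norm_mul]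
      refine mul_le_mul ?_ h1 (norm_nonneg _) (by positivity)
      linarith [norm_sub_le (q t) z, hq t]
  have hode {y : ℝ → ℂ} (hy : IsHillSolution q z y) (t : ℝ) :
      HasDerivAt (fun x => (y x, deriv y x)) (v t (y t, deriv y t)) t ∧
        (y t, deriv y t) ∈ Set.univ := by
    refine ⟨?_, Set.mem_univ _⟩
    have h := (hy.1 t).hasDerivAt.prodMk (hy.2.1 t).hasDerivAt
    rwa [show deriv (deriv y) t = (q t - z) * y t by linear_combination -hy.2.2 t] at h
  have h := ODE_solution_unique_univ (t₀ := 0) hv (hode hf) (hode hg) (by simp [h0, h0'])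
  exact funext fun x => congrArg Prod.fst (congrFun h x)

theorem exists_eq_linearCombination (hf : IsHillSolution q z f) (hg : IsHillSolution q z g)
    {C : ℝ} (hq : ∀ x, ‖q x‖ ≤ C) (hgz : g ≠ 0)
    (hind : ∀ α β : ℂ, (∀ x, α * f x + β * g x = 0) → α = 0)
    {y : ℝ → ℂ} (hy : IsHillSolution q z y) :
    ∃ α β : ℂ, y = fun x => α * f x + β * g x := by
  have hzero : IsHillSolution q z fun _ => 0 := by simpa using hf.linearCombination hg 0 0
  have hcoef (α β : ℂ) (h0 : α * f 0 + β * g 0 = 0)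
      (h0' : α * deriv f 0 + β * deriv g 0 = 0) : α = 0 := by
    refine hind α β fun x => congrFun ((hf.linearCombination hg α β).eq_of_cauchyData hzero hq
      h0 ?_) x
    rw [hf.deriv_linearCombination hg, deriv_const]
    exact h0'
  have hW : f 0 * deriv g 0 - deriv f 0 * g 0 ≠ 0 := by
    intro hW
    have hg0 := hcoef (g 0) (-f 0) (by ring) (by linear_combination -hW)
    have hg0' := hcoef (deriv g 0) (-deriv f 0) (by linear_combination hW) (by ring)
    exact hgz (hg.eq_of_cauchyData hzero hq hg0 (by simp [hg0']))
  refine ⟨(y 0 * deriv g 0 - deriv y 0 * g 0) / (f 0 * deriv g 0 - deriv f 0 * g 0),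
    (f 0 * deriv y 0 - deriv f 0 * y 0) / (f 0 * deriv g 0 - deriv f 0 * g 0),
    hy.eq_of_cauchyData (hf.linearCombination hg _ _) hq ?_ ?_⟩
  · rw [div_mul_eq_mul_div, div_mul_eq_mul_div, ← add_div, eq_div_iff hW]
    ring
  · rw [hf.deriv_linearCombination hg]
    beta_reduce
    rw [div_mul_eq_mul_div, div_mul_eq_mul_div, ← add_div, eq_div_iff hW]
    ring

end IsHillSolution

theorem eq_zero_of_quasiperiodic {f g : ℝ → ℂ} {T : ℝ} {u w : ℂ} (huw : u ≠ w) (hfz : f ≠ 0)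
    (hf : ∀ x, f (x + T) = u * f x) (hg : ∀ x, g (x + T) = w * g x) {α β : ℂ}
    (h : ∀ x, α * f x + β * g x = 0) : α = 0 := by
  obtain ⟨x, hx⟩ := Function.ne_iff.1 hfz
  have h1 := h (x + T)
  rw [hf, hg] at h1
  have h2 : (u - w) * f x * α = 0 := by linear_combination h1 - w * h x
  exact (mul_eq_zero.1 h2).resolve_left (mul_ne_zero (sub_ne_zero.2 huw) hx)

theorem periodic_of_isHillSolution {b : ℕ → ℂ} (hb : Summable fun k => ‖b k‖) {n : ℕ}
    (hn : 3 ≤ n) {y : ℝ → ℂ}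
    (hy : IsHillSolution (trigSeries (fun k => (k + 1) * n) b) 1 y) :
    Function.Periodic y (2 * Real.pi) := by
  have hn0 : n ≠ 0 := by omega
  have hnC : (n : ℂ) ≠ 0 := Nat.cast_ne_zero.2 hn0
  have hpos : |(1 : ℝ)| = 1 := abs_one
  have hneg : |(-1 : ℝ)| = 1 := by simp
  have hq (x : ℝ) : ‖trigSeries (fun k => (k + 1) * n) b x‖ ≤ ∑' k, ‖b k‖ := by
    refine tsum_of_norm_bounded hb.hasSum fun k => ?_
    exact (norm_trigSeries_term (fun k => (k + 1) * n) b x k).le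
  have hne {μ : ℝ} (hμ : |μ| = 1) : floquetSolution b μ n ≠ 0 :=
    trigSeries_ne_zero hn0 (summable_norm_floquetCoeff hb hμ hn) (by simp [floquetCoeff_zero])
  have hT : Complex.exp (Complex.I * n * ((2 * Real.pi / n : ℝ) : ℂ)) = 1 := by
    rw [Complex.exp_eq_one_iff]
    exact ⟨1, by push_cast; field_simp⟩
  have hmult : Complex.exp (Complex.I * (1 : ℝ) * ((2 * Real.pi / n : ℝ) : ℂ)) ≠
      Complex.exp (Complex.I * (-1 : ℝ) * ((2 * Real.pi / n : ℝ) : ℂ)) := by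
    intro h
    obtain ⟨m, hm⟩ := Complex.exp_eq_exp_iff_exists_int.1 h
    have h2 : (2 : ℂ) = m * n := by
      have hp : (2 * Real.pi * Complex.I : ℂ) ≠ 0 := Complex.two_pi_I_ne_zero
      apply mul_left_cancel₀ hp
      push_cast at hm
      field_simp at hm
      linear_combination (2 * Real.pi * Complex.I : ℂ) * hm
    have h3 : (2 : ℤ) = m * n := by exact_mod_cast h2
    have := Int.le_of_dvd two_pos (Dvd.intro_left m h3.symm)
    omega
  obtain ⟨α, β, rfl⟩ := (isHillSolution_floquetSolution hb hpos hn).exists_eq_linearCombination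
    (isHillSolution_floquetSolution hb hneg hn) hq (hne hneg)
    (fun α β h => eq_zero_of_quasiperiodic hmult (hne hpos) (trigSeries_add _ hT)
      (trigSeries_add _ hT) h) hy
  have hexp (m : ℤ) : Complex.exp (Complex.I * m * ((2 * Real.pi : ℝ) : ℂ)) = 1 := by
    rw [Complex.exp_eq_one_iff]
    exact ⟨m, by push_cast; ring⟩
  have hper {μ : ℝ} (m : ℤ) (hm : μ = m) :
      Function.Periodic (floquetSolution b μ n) (2 * Real.pi) := by
    intro x
    have h := trigSeries_add (μ := μ) (floquetCoeff b μ n) (by exact_mod_cast hexp n) x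
    rw [show (μ : ℂ) = m by rw [hm]; simp, hexp, one_mul] at h
    exact h
  intro x
  simp only [hper (μ := 1) 1 (by simp) x, hper (μ := -1) (-1) (by simp) x]

/-- The derivative at `2π` of the variation of constants formula, at spectral parameter `1`. -/
theorem IsHillSolution.integral_cos_mul {q y : ℝ → ℂ} (hy : IsHillSolution q 1 y)
    (hq : Continuous q) :
    (∫ t in (0 : ℝ)..(2 * Real.pi), (Real.cos (2 * Real.pi - t) : ℂ) * q t * y t) =
      deriv y (2 * Real.pi) - deriv y 0 := by
  have hd (t : ℝ) : HasDerivAt (fun t : ℝ => (Real.cos t : ℂ) * deriv y t + Real.sin t * y t)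
      ((Real.cos (2 * Real.pi - t) : ℂ) * q t * y t) t := by
    have h := ((Real.hasDerivAt_cos t).ofReal_comp.mul (hy.2.1 t).hasDerivAt).add
      ((Real.hasDerivAt_sin t).ofReal_comp.mul (hy.1 t).hasDerivAt)
    refine h.congr_deriv ?_
    rw [Real.cos_two_pi_sub]
    push_cast
    linear_combination (-Complex.cos t) * hy.2.2 t
  have hcont : Continuous fun t : ℝ => (Real.cos (2 * Real.pi - t) : ℂ) * q t * y t := by
    have := hy.1.continuous
    fun_prop
  rw [intervalIntegral.integral_eq_sub_of_hasDerivAt (fun t _ => hd t)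
    (hcont.intervalIntegrable _ _)]
  simp

theorem continuous_trigSeries {ν : ℕ → ℝ} {c : ℕ → ℂ} (hc : Summable fun k => ‖c k‖) :
    Continuous (trigSeries ν c) :=
  continuous_tsum (fun k => by fun_prop) hc fun k x => (norm_trigSeries_term ν c x k).le

/-- For `qₙ(x) = n² ∑_{k=1}^∞ a_k e^{iknx}` with `∑|a_k| < ∞` and `n ≥ 3`, the fundamental
solution `s = s(qₙ;1,·)` satisfies `∫₀^{2π} cos(2π - t) qₙ(t) s(t) dt = 0` and `s'(2π) = 1`. -/
theorem integral_vanishes_and_s_deriv_two_pi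
    (a : ℕ → ℂ) (ha : Summable fun k => ‖a k‖)
    (n : ℕ) (hn : 3 ≤ n)
    (qn : ℝ → ℂ)
    (hq : ∀ x : ℝ, qn x =
      (n : ℂ) ^ 2 * ∑' k : ℕ, a k * Complex.exp (Complex.I * (((k : ℂ) + 1) * n) * (x : ℂ)))
    (s : ℝ → ℂ)
    (hs : IsHillSolution qn 1 s) (hs0 : s 0 = 0) (hs0' : deriv s 0 = 1) :
    (∫ t in (0 : ℝ)..(2 * Real.pi), (Real.cos (2 * Real.pi - t) : ℂ) * qn t * s t) = 0 ∧
      deriv s (2 * Real.pi) = 1 := by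
  have hb : Summable fun k => ‖(n : ℂ) ^ 2 * a k‖ := by
    simpa only [norm_mul] using ha.mul_left ‖(n : ℂ) ^ 2‖
  have hqn : qn = trigSeries (fun k => (k + 1) * n) fun k => (n : ℂ) ^ 2 * a k := by
    funext x
    rw [hq, trigSeries, ← tsum_mul_left]
    exact tsum_congr fun k => by push_cast; ring
  subst hqn
  have hper : deriv s (2 * Real.pi) = deriv s 0 := by
    have h := periodic_of_isHillSolution hb hn hs
    rw [← zero_add (2 * Real.pi), ← deriv_comp_add_const]
    exact congrArg (fun f => deriv f 0) (funext h)
  rw [hs.integral_cos_mul (continuous_trigSeries hb), hper, hs0', sub_self]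
  exact ⟨rfl, rfl⟩
end
end
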